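/- arXiv:math/0504599 — 3 statements merged into one kernel-verified Lean document; each statement's English description precedes it below -/
import Mathlib

section
/- Let f : G → H be a weakly quadratic map between groups. Then f([a,[b,c]]) = [f(a), [f(b), f(c)]] for all a, b, c ∈ G. Consequently, if H has nilpotence class two, then f(c) = 1 for every c in the subgroup [G,[G,G]] and f(a·c) = f(a) for all a ∈ G and c ∈ [G,[G,G]]; i.e. f factors through the quotient G/[G,[G,G]]. -/
/-- The cross-effect of a map between groups: `(a|b)_f = (f a * f b)⁻¹ * f (a*b)`. -/
def crossEff {G H : Type*} [Group G] [Group H] (f : G → H) (a b : G) : H :=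
  (f a * f b)⁻¹ * f (a * b)

/-- The commutator `[a,b] = a⁻¹ * b⁻¹ * a * b`. -/
def cmt {G : Type*} [Group G] (a b : G) : G := a⁻¹ * b⁻¹ * a * b

/-- A map between groups is weakly quadratic if its cross-effect commutes with all values
of `f` and is multiplicative in each variable. -/
def IsWeaklyQuadratic {G H : Type*} [Group G] [Group H] (f : G → H) : Prop :=
  (∀ a b c : G, Commute (crossEff f a b) (f c)) ∧
  (∀ a a' b : G, crossEff f (a * a') b = crossEff f a b * crossEff f a' b) ∧
  (∀ a b b' : G, crossEff f a (b * b') = crossEff f a b * crossEff f a b')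

/-- A quadratic map: weakly quadratic with central cross-effect values. -/
def IsQuadratic {G H : Type*} [Group G] [Group H] (f : G → H) : Prop :=
  IsWeaklyQuadratic f ∧ ∀ a b : G, crossEff f a b ∈ Subgroup.center H

/-- A q-map: weakly quadratic with cross-effect values in the commutator subgroup. -/
def IsQMap {G H : Type*} [Group G] [Group H] (f : G → H) : Prop :=
  IsWeaklyQuadratic f ∧ ∀ a b : G, crossEff f a b ∈ commutator H

open scoped commutatorElement

theorem map_mul_crossEff {G H : Type*} [Group G] [Group H] (f : G → H) (a b : G) :
    f (a * b) = f a * f b * crossEff f a b := by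
  rw [crossEff, mul_inv_cancel_left]

theorem mul_cmt_eq {G : Type*} [Group G] (a b : G) : b * a * cmt a b = a * b := by
  simp [cmt, mul_assoc]

theorem commutatorElement_eq_cmt {G : Type*} [Group G] (a b : G) :
    ⁅a, b⁆ = cmt a⁻¹ b⁻¹ := by
  simp [cmt, commutatorElement_def]

theorem cmt_eq_commutatorElement {G : Type*} [Group G] (a b : G) :
    cmt a b = ⁅a⁻¹, b⁻¹⁆ := by
  simp [commutatorElement_eq_cmt]

theorem cmt_mul_right_of_commute {H : Type*} [Group H] {x y z : H}
    (hx : Commute z x) (hy : Commute z y) : cmt x (y * z) = cmt x y := by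
  have h1 : y * z = z * y := hy.eq.symm
  calc cmt x (y * z) = x⁻¹ * (z * y)⁻¹ * x * (z * y) := by rw [cmt, h1]
    _ = x⁻¹ * y⁻¹ * (z⁻¹ * x * z) * y := by group
    _ = cmt x y := by
      have : z⁻¹ * x * z = x := by rw [mul_assoc, ← hx.eq, inv_mul_cancel_left]
      rw [this, cmt]

namespace IsWeaklyQuadratic

variable {G H : Type*} [Group G] [Group H] {f : G → H}

theorem commute_crossEff (hf : IsWeaklyQuadratic f) (a b c d : G) :
    Commute (crossEff f a b) (crossEff f c d) :=
  ((hf.1 a b c).mul_right (hf.1 a b d)).inv_right.mul_right (hf.1 a b (c * d))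

/-- The cross-effect as a homomorphism in its second variable. -/
def crossEffHom (hf : IsWeaklyQuadratic f) (a : G) : G →* H :=
  MonoidHom.mk' (crossEff f a) (hf.2.2 a)

theorem crossEff_one_right (hf : IsWeaklyQuadratic f) (a : G) : crossEff f a 1 = 1 :=
  (hf.crossEffHom a).map_one

theorem crossEff_inv_right (hf : IsWeaklyQuadratic f) (a b : G) :
    crossEff f a b⁻¹ = (crossEff f a b)⁻¹ :=
  (hf.crossEffHom a).map_inv b

theorem map_one (hf : IsWeaklyQuadratic f) : f 1 = 1 := by
  have h := map_mul_crossEff f 1 1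
  rw [hf.crossEff_one_right, mul_one, mul_one] at h
  exact left_eq_mul.mp h

theorem crossEff_cmt_right (hf : IsWeaklyQuadratic f) (a b c : G) :
    crossEff f a (cmt b c) = 1 := by
  have h := (hf.commute_crossEff a c a b).eq
  rw [← hf.2.2, ← hf.2.2, ← mul_cmt_eq b c, hf.2.2 a (c * b)] at h
  exact left_eq_mul.mp h

theorem map_cmt (hf : IsWeaklyQuadratic f) (a b : G) :
    f (cmt a b) = cmt (f a) (f b) * (crossEff f a b * (crossEff f b a)⁻¹) := by
  have h := map_mul_crossEff f (b * a) (cmt a b)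
  rw [mul_cmt_eq, hf.crossEff_cmt_right, mul_one, map_mul_crossEff f a b,
    map_mul_crossEff f b a] at h
  have hc : Commute (crossEff f b a)⁻¹ ((f b * f a)⁻¹ * (f a * f b * crossEff f a b)) :=
    (((hf.1 b a b).mul_right (hf.1 b a a)).inv_right.mul_right
      (((hf.1 b a a).mul_right (hf.1 b a b)).mul_right
        (hf.commute_crossEff b a a b))).inv_left
  calc f (cmt a b)
      = (crossEff f b a)⁻¹ * ((f b * f a)⁻¹ * (f a * f b * crossEff f a b)) := by
        rw [h]; group
    _ = ((f b * f a)⁻¹ * (f a * f b * crossEff f a b)) * (crossEff f b a)⁻¹ := hc.eq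
    _ = _ := by simp only [cmt]; group

theorem crossEff_one_left (hf : IsWeaklyQuadratic f) (a : G) : crossEff f 1 a = 1 := by
  simp [crossEff, hf.map_one]

theorem crossEff_inv_left (hf : IsWeaklyQuadratic f) (a b : G) :
    crossEff f a⁻¹ b = (crossEff f a b)⁻¹ := by
  rw [eq_inv_iff_mul_eq_one, ← hf.2.1, inv_mul_cancel, hf.crossEff_one_left]

theorem crossEff_cmt_left (hf : IsWeaklyQuadratic f) (a b c : G) :
    crossEff f (cmt b c) a = 1 := by
  have h := (hf.commute_crossEff c a b a).eq
  rw [← hf.2.1, ← hf.2.1, ← mul_cmt_eq b c, hf.2.1 (c * b)] at h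
  exact left_eq_mul.mp h

theorem map_inv_of_crossEff_eq_one (hf : IsWeaklyQuadratic f) {u : G}
    (hu : crossEff f u u = 1) : f u⁻¹ = (f u)⁻¹ := by
  have h := map_mul_crossEff f u u⁻¹
  rw [mul_inv_cancel, hf.map_one, hf.crossEff_inv_right, hu, inv_one, mul_one] at h
  exact eq_inv_of_mul_eq_one_right h.symm

theorem map_cmt_cmt (hf : IsWeaklyQuadratic f) (a b c : G) :
    f (cmt a (cmt b c)) = cmt (f a) (cmt (f b) (f c)) := by
  have hz (x : G) : Commute (crossEff f b c * (crossEff f c b)⁻¹) (f x) :=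
    (hf.1 b c x).mul_left (hf.1 c b x).inv_left
  have hcmt : Commute (crossEff f b c * (crossEff f c b)⁻¹) (cmt (f b) (f c)) :=
    (((hz b).inv_right.mul_right (hz c).inv_right).mul_right (hz b)).mul_right (hz c)
  rw [hf.map_cmt a, hf.crossEff_cmt_right, hf.crossEff_cmt_left, hf.map_cmt b c,
    inv_one, mul_one, mul_one, cmt_mul_right_of_commute (hz a) hcmt]

/-- The elements of the two-sided kernel of the cross-effect that `f` maps into `K`. -/
def kerPreimage (hf : IsWeaklyQuadratic f) (K : Subgroup H) : Subgroup G where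
  carrier := {u | (∀ x, crossEff f x u = 1 ∧ crossEff f u x = 1) ∧ f u ∈ K}
  one_mem' := ⟨fun x => ⟨hf.crossEff_one_right x, hf.crossEff_one_left x⟩,
    hf.map_one ▸ K.one_mem⟩
  mul_mem' := by
    rintro u v ⟨hu, huK⟩ ⟨hv, hvK⟩
    refine ⟨fun x => ⟨?_, ?_⟩, ?_⟩
    · rw [hf.2.2, (hu x).1, (hv x).1, mul_one]
    · rw [hf.2.1, (hu x).2, (hv x).2, mul_one]
    · rw [map_mul_crossEff f, (hu v).2, mul_one]
      exact K.mul_mem huK hvK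
  inv_mem' := by
    rintro u ⟨hu, huK⟩
    refine ⟨fun x => ⟨?_, ?_⟩, ?_⟩
    · rw [hf.crossEff_inv_right, (hu x).1, inv_one]
    · rw [hf.crossEff_inv_left, (hu x).2, inv_one]
    · rw [hf.map_inv_of_crossEff_eq_one (hu u).1]
      exact K.inv_mem huK

theorem cmt_mem_kerPreimage (hf : IsWeaklyQuadratic f) {K : Subgroup H} {a b : G}
    (h : f (cmt a b) ∈ K) : cmt a b ∈ hf.kerPreimage K :=
  ⟨fun x => ⟨hf.crossEff_cmt_right x a b, hf.crossEff_cmt_left x a b⟩, h⟩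

theorem commutator_le_kerPreimage_centralizer (hf : IsWeaklyQuadratic f)
    (hH : commutator H ≤ Subgroup.center H) :
    commutator G ≤ hf.kerPreimage (Subgroup.centralizer (Set.range f)) := by
  rw [commutator_def, Subgroup.commutator_le]
  intro a _ b _
  rw [commutatorElement_eq_cmt]
  apply hf.cmt_mem_kerPreimage
  rw [hf.map_cmt]
  refine mul_mem (Subgroup.center_le_centralizer _ (hH ?_)) (mul_mem ?_ (inv_mem ?_))
  · rw [cmt_eq_commutatorElement]
    exact Subgroup.commutator_mem_commutator (Subgroup.mem_top _) (Subgroup.mem_top _)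
  all_goals
    rw [Subgroup.mem_centralizer_iff]
    rintro _ ⟨x, rfl⟩
    exact (hf.1 _ _ x).eq.symm

theorem commutator_top_commutator_le_kerPreimage_bot (hf : IsWeaklyQuadratic f)
    (hH : commutator H ≤ Subgroup.center H) :
    ⁅(⊤ : Subgroup G), commutator G⁆ ≤ hf.kerPreimage ⊥ := by
  rw [Subgroup.commutator_le]
  intro a _ b hb
  obtain ⟨hker, hcomm⟩ := hf.commutator_le_kerPreimage_centralizer hH (inv_mem hb)
  rw [commutatorElement_eq_cmt]
  apply hf.cmt_mem_kerPreimage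
  have hfx : Commute (f a⁻¹) (f b⁻¹) :=
    Subgroup.mem_centralizer_iff.mp hcomm _ ⟨a⁻¹, rfl⟩
  rw [Subgroup.mem_bot, hf.map_cmt, (hker a⁻¹).1, (hker a⁻¹).2, inv_one, mul_one, mul_one,
    cmt_eq_commutatorElement, commutatorElement_eq_one_iff_commute]
  exact hfx.inv_inv

end IsWeaklyQuadratic

theorem stmt_4 {G H : Type*} [Group G] [Group H] (f : G → H)
    (hf : IsWeaklyQuadratic f) :
    (∀ a b c : G, f (cmt a (cmt b c)) = cmt (f a) (cmt (f b) (f c))) ∧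
    (commutator H ≤ Subgroup.center H →
      (∀ c ∈ ⁅(⊤ : Subgroup G), commutator G⁆, f c = 1) ∧
      (∀ a : G, ∀ c ∈ ⁅(⊤ : Subgroup G), commutator G⁆, f (a * c) = f a)) := by
  refine ⟨hf.map_cmt_cmt, fun hH => ?_⟩
  have hker := hf.commutator_top_commutator_le_kerPreimage_bot hH
  refine ⟨fun c hc => (hker hc).2, fun a c hc => ?_⟩
  obtain ⟨hu, hfc⟩ := hker hc
  rw [map_mul_crossEff f, (hu a).1, Subgroup.mem_bot.mp hfc, mul_one, mul_one]
end

section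
/- Let G₁, G₂, H be groups and f : G₁ × G₂ → H a quadratic map such that f(g₁, 1) = 1 and f(1, g₂) = 1 for all g₁ ∈ G₁, g₂ ∈ G₂. Then for all g₁ ∈ G₁ and g₂ ∈ G₂ one has f(g₁, g₂) = ((g₁,1) | (1,g₂))_f. In particular f takes values in Z(H), f(g₁, g₂) depends only on the classes of g₁ and g₂ in the abelianizations G₁_ab and G₂_ab, and (g₁, g₂) ↦ f(g₁, g₂) is multiplicative in each variable. -/
/-- A multiplicative map with central values is trivial on the commutator subgroup. -/
theorem map_eq_one_of_mem_commutator {G H : Type*} [Group G] [Group H] (φ : G → H)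
    (hmul : ∀ a b, φ (a * b) = φ a * φ b) (hcenter : ∀ a, φ a ∈ Subgroup.center H)
    {c : G} (hc : c ∈ commutator G) : φ c = 1 := by
  let ψ : G →* H := MonoidHom.mk' φ hmul
  have hker : commutator G ≤ ψ.ker := by
    rw [commutator_def, Subgroup.commutator_le]
    intro a _ b _
    rw [MonoidHom.mem_ker, map_commutatorElement, commutatorElement_eq_one_iff_mul_comm]
    exact (Subgroup.mem_center_iff.mp (hcenter a) (φ b)).symm
  exact MonoidHom.mem_ker.mp (hker hc)

theorem stmt_7 {G₁ G₂ H : Type*} [Group G₁] [Group G₂] [Group H]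
    (f : G₁ × G₂ → H) (hf : IsQuadratic f)
    (h1 : ∀ g₁ : G₁, f (g₁, 1) = 1) (h2 : ∀ g₂ : G₂, f (1, g₂) = 1) :
    (∀ (g₁ : G₁) (g₂ : G₂), f (g₁, g₂) = crossEff f (g₁, 1) (1, g₂)) ∧
    (∀ (g₁ : G₁) (g₂ : G₂), f (g₁, g₂) ∈ Subgroup.center H) ∧
    (∀ (g₁ : G₁) (g₂ : G₂), ∀ c ∈ commutator G₁, f (g₁ * c, g₂) = f (g₁, g₂)) ∧
    (∀ (g₁ : G₁) (g₂ : G₂), ∀ c ∈ commutator G₂, f (g₁, g₂ * c) = f (g₁, g₂)) ∧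
    (∀ (g₁ g₁' : G₁) (g₂ : G₂), f (g₁ * g₁', g₂) = f (g₁, g₂) * f (g₁', g₂)) ∧
    (∀ (g₁ : G₁) (g₂ g₂' : G₂), f (g₁, g₂ * g₂') = f (g₁, g₂) * f (g₁, g₂')) := by
  have key : ∀ (g₁ : G₁) (g₂ : G₂), f (g₁, g₂) = crossEff f (g₁, 1) (1, g₂) := by
    intro g₁ g₂
    simp [crossEff, h1, h2]
  have hcenter : ∀ (g₁ : G₁) (g₂ : G₂), f (g₁, g₂) ∈ Subgroup.center H := by
    intro g₁ g₂
    rw [key]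
    exact hf.2 _ _
  have hmul₁ : ∀ (g₁ g₁' : G₁) (g₂ : G₂), f (g₁ * g₁', g₂) = f (g₁, g₂) * f (g₁', g₂) := by
    intro g₁ g₁' g₂
    rw [key, key g₁, key g₁', ← hf.1.2.1, Prod.mk_mul_mk, one_mul]
  have hmul₂ : ∀ (g₁ : G₁) (g₂ g₂' : G₂), f (g₁, g₂ * g₂') = f (g₁, g₂) * f (g₁, g₂') := by
    intro g₁ g₂ g₂'
    rw [key, key g₁ g₂, key g₁ g₂', ← hf.1.2.2, Prod.mk_mul_mk, one_mul]
  refine ⟨key, hcenter, fun g₁ g₂ c hc => ?_, fun g₁ g₂ c hc => ?_, hmul₁, hmul₂⟩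
  · rw [hmul₁, map_eq_one_of_mem_commutator (fun a => f (a, g₂))
      (fun a b => hmul₁ a b g₂) (fun a => hcenter a g₂) hc, mul_one]
  · rw [hmul₂, map_eq_one_of_mem_commutator (fun b => f (g₁, b))
      (hmul₂ g₁) (hcenter g₁) hc, mul_one]
end

section
/- Let G and H be groups of nilpotence class two. (1) If f, g : G → H are q-maps, then the pointwise product f·g (defined by (f·g)(x) = f(x)·g(x)) and the pointwise inverse f⁻¹ are q-maps; in particular any pointwise product of group homomorphisms G → H is a q-map. (2) If f : G → H is quadratic and g : G → H is a q-map, then the map x ↦ f(x)·g(x)·f(x)⁻¹ is a q-map, with cross-effect (a|b) = (a|b)_g·[f(b), g(a)]·([g(b), f(a)])⁻¹. -/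
section NilpotencyClassTwo

variable {G H : Type*} [Group G] [Group H]

theorem cmt_mem_commutator (x y : H) : cmt x y ∈ commutator H := by
  have h := Subgroup.commutator_mem_commutator
    (Subgroup.mem_top x⁻¹) (Subgroup.mem_top y⁻¹)
  simpa [commutatorElement_def, cmt, commutator_def] using h

theorem mul_eq_mul_mul_cmt (x y : H) : x * y = y * x * cmt x y := by
  simp only [cmt]; group

theorem cmt_mul_of_mem_center {z : H} (hz : z ∈ Subgroup.center H) (x y : H) :
    cmt (x * z) y = cmt x y := by
  have h := Subgroup.mem_center_iff.1 hz
  calc (x * z)⁻¹ * y⁻¹ * (x * z) * y = z⁻¹ * (x⁻¹ * y⁻¹ * x * (z * y)) := by group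
    _ = z⁻¹ * (x⁻¹ * y⁻¹ * x * y * z) := by rw [← h y]; group
    _ = cmt x y := by rw [h, inv_mul_cancel_left]; rfl

theorem cmt_inv (x y : H) : (cmt x y)⁻¹ = cmt y x := by
  simp only [cmt]; group

theorem map_mul_eq_mul_crossEff (f : G → H) (a b : G) :
    f (a * b) = f a * f b * crossEff f a b := by
  simp only [crossEff, mul_inv_cancel_left]

theorem cmt_mul_left (hH : commutator H ≤ Subgroup.center H) (x x' y : H) :
    cmt (x * x') y = cmt x y * cmt x' y := by
  have h := Subgroup.mem_center_iff.1 (hH (cmt_mem_commutator x y))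
  calc cmt (x * x') y = x'⁻¹ * cmt x y * (y⁻¹ * x' * y) := by simp only [cmt]; group
    _ = cmt x y * cmt x' y := by rw [h]; simp only [cmt]; group

theorem cmt_map_mul_left (hH : commutator H ≤ Subgroup.center H) {f : G → H}
    (hf : ∀ a b, crossEff f a b ∈ Subgroup.center H) (a b : G) (y : H) :
    cmt (f (a * b)) y = cmt (f a) y * cmt (f b) y := by
  rw [map_mul_eq_mul_crossEff f, cmt_mul_of_mem_center (hf a b), cmt_mul_left hH]

theorem cmt_map_mul_right (hH : commutator H ≤ Subgroup.center H) {f : G → H}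
    (hf : ∀ a b, crossEff f a b ∈ Subgroup.center H) (a b : G) (y : H) :
    cmt y (f (a * b)) = cmt y (f a) * cmt y (f b) := by
  rw [← cmt_inv, cmt_map_mul_left hH hf, mul_inv_rev, cmt_inv, cmt_inv]
  exact (Subgroup.mem_center_iff.1 (hH (cmt_mem_commutator y (f a))) _)

theorem mul_mul_mul_comm_of_mem_center {y : H} (hy : y ∈ Subgroup.center H) (x z w : H) :
    x * y * (z * w) = x * z * (y * w) := by
  rw [mul_assoc, ← mul_assoc y, ← Subgroup.mem_center_iff.1 hy z]
  simp only [mul_assoc]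

theorem crossEff_mul (hH : commutator H ≤ Subgroup.center H) {f g : G → H}
    (hf : ∀ a b, crossEff f a b ∈ Subgroup.center H) (a b : G) :
    crossEff (fun x => f x * g x) a b = cmt (f b) (g a) * crossEff f a b * crossEff g a b := by
  have hc := Subgroup.mem_center_iff.1 (hf a b)
  have hk := Subgroup.mem_center_iff.1 (hH (cmt_mem_commutator (f b) (g a)))
  refine inv_mul_eq_of_eq_mul ?_
  calc f (a * b) * g (a * b)
      = f a * f b * (crossEff f a b * (g a * g b)) * crossEff g a b := by
        rw [map_mul_eq_mul_crossEff f, map_mul_eq_mul_crossEff g]; group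
    _ = f a * (f b * g a) * g b * (crossEff f a b * crossEff g a b) := by
        rw [← hc]; group
    _ = f a * g a * f b * (cmt (f b) (g a) * g b) * (crossEff f a b * crossEff g a b) := by
        rw [mul_eq_mul_mul_cmt (f b)]; group
    _ = _ := by rw [← hk]; group

theorem crossEff_inv (hH : commutator H ≤ Subgroup.center H) {f : G → H}
    (hf : ∀ a b, crossEff f a b ∈ Subgroup.center H) (a b : G) :
    crossEff (fun x => (f x)⁻¹) a b = cmt (f b) (f a) * (crossEff f a b)⁻¹ := by
  have h := Subgroup.mem_center_iff.1
    (mul_mem (hH (cmt_mem_commutator (f b) (f a))) (inv_mem (hf a b)))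
  calc ((f a)⁻¹ * (f b)⁻¹)⁻¹ * (f (a * b))⁻¹
      = f b * f a * (crossEff f a b)⁻¹ * (f a * f b)⁻¹ := by
        rw [map_mul_eq_mul_crossEff f]; group
    _ = f a * f b * (cmt (f b) (f a) * (crossEff f a b)⁻¹) * (f a * f b)⁻¹ := by
        rw [mul_eq_mul_mul_cmt (f b)]; group
    _ = _ := by rw [h, mul_inv_cancel_right]

theorem crossEff_cmt (hH : commutator H ≤ Subgroup.center H) {f g : G → H}
    (hf : ∀ a b, crossEff f a b ∈ Subgroup.center H)
    (hg : ∀ a b, crossEff g a b ∈ Subgroup.center H) (a b : G) :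
    crossEff (fun x => cmt (f x) (g x)) a b = cmt (f b) (g a) * cmt (f a) (g b) := by
  have h (x y : G) := Subgroup.mem_center_iff.1 (hH (cmt_mem_commutator (f x) (g y)))
  refine inv_mul_eq_of_eq_mul ?_
  beta_reduce
  rw [cmt_map_mul_left hH hf, cmt_map_mul_right hH hg, cmt_map_mul_right hH hg,
    mul_assoc (cmt (f a) (g a)), ← h a b, h b b (cmt (f b) (g a))]
  simp only [mul_assoc]

theorem crossEff_conj (hH : commutator H ≤ Subgroup.center H) {f g : G → H}
    (hf : ∀ a b, crossEff f a b ∈ Subgroup.center H)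
    (hg : ∀ a b, crossEff g a b ∈ Subgroup.center H) (a b : G) :
    crossEff (fun x => f x * g x * (f x)⁻¹) a b
      = crossEff g a b * cmt (f b) (g a) * (cmt (g b) (f a))⁻¹ := by
  have hconj : (fun x => f x * g x * (f x)⁻¹) = fun x => g x * cmt (f x) (g x) := by
    funext x
    rw [mul_eq_mul_mul_cmt (f x), mul_assoc (g x),
      Subgroup.mem_center_iff.1 (hH (cmt_mem_commutator (f x) (g x))) (f x)]
    group
  have h1 : cmt (g b) (cmt (f a) (g a)) = 1 := by
    have h := Subgroup.mem_center_iff.1 (hH (cmt_mem_commutator (f a) (g a))) (g b)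
    rw [cmt, mul_assoc, h]
    group
  rw [hconj, crossEff_mul hH hg, h1, crossEff_cmt hH hf hg, cmt_inv, one_mul, mul_assoc]

/-- A pairing with values in the commutator subgroup which is multiplicative in each variable. -/
structure IsCommutatorPairing (B : G → G → H) : Prop where
  mem_commutator : ∀ a b, B a b ∈ commutator H
  mul_left : ∀ a a' b, B (a * a') b = B a b * B a' b
  mul_right : ∀ a b b', B a (b * b') = B a b * B a b'

namespace IsCommutatorPairing

theorem mul (hH : commutator H ≤ Subgroup.center H) {B C : G → G → H}
    (hB : IsCommutatorPairing B) (hC : IsCommutatorPairing C) :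
    IsCommutatorPairing fun a b => B a b * C a b where
  mem_commutator a b := mul_mem (hB.mem_commutator a b) (hC.mem_commutator a b)
  mul_left a a' b := by
    rw [hB.mul_left, hC.mul_left, mul_mul_mul_comm_of_mem_center (hH (hB.mem_commutator a' b))]
  mul_right a b b' := by
    rw [hB.mul_right, hC.mul_right, mul_mul_mul_comm_of_mem_center (hH (hB.mem_commutator a b'))]

theorem inv (hH : commutator H ≤ Subgroup.center H) {B : G → G → H}
    (hB : IsCommutatorPairing B) : IsCommutatorPairing fun a b => (B a b)⁻¹ where
  mem_commutator a b := inv_mem (hB.mem_commutator a b)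
  mul_left a a' b := by
    rw [hB.mul_left, ← Subgroup.mem_center_iff.1 (hH (hB.mem_commutator a b)), mul_inv_rev]
  mul_right a b b' := by
    rw [hB.mul_right, ← Subgroup.mem_center_iff.1 (hH (hB.mem_commutator a b)), mul_inv_rev]

theorem cmt (hH : commutator H ≤ Subgroup.center H) {f g : G → H}
    (hf : ∀ a b, crossEff f a b ∈ Subgroup.center H)
    (hg : ∀ a b, crossEff g a b ∈ Subgroup.center H) :
    IsCommutatorPairing fun a b => _root_.cmt (f b) (g a) where
  mem_commutator _ _ := cmt_mem_commutator _ _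
  mul_left _ _ _ := cmt_map_mul_right hH hg _ _ _
  mul_right _ _ _ := cmt_map_mul_left hH hf _ _ _

end IsCommutatorPairing

theorem isQMap_iff (hH : commutator H ≤ Subgroup.center H) {f : G → H} :
    IsQMap f ↔ IsCommutatorPairing (crossEff f) :=
  ⟨fun h => ⟨h.2, h.1.2.1, h.1.2.2⟩, fun h =>
    ⟨⟨fun a b c => (Subgroup.mem_center_iff.1 (hH (h.mem_commutator a b)) (f c)).symm,
      h.mul_left, h.mul_right⟩, h.mem_commutator⟩⟩

theorem IsQMap.crossEff_mem_center (hH : commutator H ≤ Subgroup.center H) {f : G → H}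
    (hf : IsQMap f) (a b : G) : crossEff f a b ∈ Subgroup.center H :=
  hH (hf.2 a b)

theorem IsQMap.mul (hH : commutator H ≤ Subgroup.center H) {f g : G → H}
    (hf : IsQMap f) (hg : IsQMap g) : IsQMap fun x => f x * g x := by
  have hfc := hf.crossEff_mem_center hH
  rw [isQMap_iff hH, funext₂ (crossEff_mul hH hfc)]
  exact ((IsCommutatorPairing.cmt hH hfc (hg.crossEff_mem_center hH)).mul hH
    ((isQMap_iff hH).1 hf)).mul hH ((isQMap_iff hH).1 hg)

theorem IsQMap.inv (hH : commutator H ≤ Subgroup.center H) {f : G → H}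
    (hf : IsQMap f) : IsQMap fun x => (f x)⁻¹ := by
  have hfc := hf.crossEff_mem_center hH
  rw [isQMap_iff hH, funext₂ (crossEff_inv hH hfc)]
  exact (IsCommutatorPairing.cmt hH hfc hfc).mul hH (((isQMap_iff hH).1 hf).inv hH)

theorem IsQMap.conj (hH : commutator H ≤ Subgroup.center H) {f g : G → H}
    (hf : ∀ a b, crossEff f a b ∈ Subgroup.center H) (hg : IsQMap g) :
    IsQMap fun x => f x * g x * (f x)⁻¹ := by
  have hgc := hg.crossEff_mem_center hH
  rw [isQMap_iff hH, funext₂ (crossEff_conj hH hf hgc)]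
  simp only [cmt_inv]
  refine (((isQMap_iff hH).1 hg).mul hH (.cmt hH hf hgc)).mul hH ?_
  exact ⟨fun _ _ => cmt_mem_commutator _ _, fun _ _ _ => cmt_map_mul_left hH hf _ _ _,
    fun _ _ _ => cmt_map_mul_right hH hgc _ _ _⟩

theorem MonoidHom.isQMap (φ : G →* H) : IsQMap φ := by
  have h (a b : G) : crossEff φ a b = 1 := by simp [crossEff]
  simp [IsQMap, IsWeaklyQuadratic, h, one_mem]

end NilpotencyClassTwo

theorem stmt_8 {G H : Type*} [Group G] [Group H]
    (hG : commutator G ≤ Subgroup.center G) (hH : commutator H ≤ Subgroup.center H) :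
    (∀ f g : G → H, IsQMap f → IsQMap g →
      IsQMap (fun x => f x * g x) ∧ IsQMap (fun x => (f x)⁻¹)) ∧
    (∀ φ ψ : G →* H, IsQMap (fun x => φ x * ψ x)) ∧
    (∀ f g : G → H, IsQuadratic f → IsQMap g →
      IsQMap (fun x => f x * g x * (f x)⁻¹) ∧
      (∀ a b : G, crossEff (fun x => f x * g x * (f x)⁻¹) a b
        = crossEff g a b * cmt (f b) (g a) * (cmt (g b) (f a))⁻¹)) := by
  exact ⟨fun _ _ hf hg => ⟨hf.mul hH hg, hf.inv hH⟩, fun φ ψ => φ.isQMap.mul hH ψ.isQMap,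
    fun _ _ hf hg => ⟨hg.conj hH hf.2, crossEff_conj hH hf.2 (hg.crossEff_mem_center hH)⟩⟩
end
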